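/- arXiv:2101.01801 — 4 statements merged into one kernel-verified Lean document; each statement's English description precedes it below -/
import Mathlib

section
/- Let k, v : ℝ³ → ℝ³ be vector fields differentiable at a point p, and suppose ‖k(p)‖ = 1 and ⟨k(p), v(p)⟩ = 0. Then ⟨k(p), curl(k × v)(p)⟩ = div v(p) − G(k, v)(p), where G(k, v)(p) = ⟨k(p), ((k·∇)v)(p)⟩ − ⟨k(p), ((v·∇)k)(p)⟩ is the spurious geometric divergence. -/
open scoped RealInnerProductSpace

noncomputable def cross3 (a b : EuclideanSpace ℝ (Fin 3)) : EuclideanSpace ℝ (Fin 3) :=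
  (WithLp.equiv 2 (Fin 3 → ℝ)).symm
    ![a 1 * b 2 - a 2 * b 1, a 2 * b 0 - a 0 * b 2, a 0 * b 1 - a 1 * b 0]

/-- Divergence: trace of the Fréchet derivative. -/
noncomputable def div3 (F : EuclideanSpace ℝ (Fin 3) → EuclideanSpace ℝ (Fin 3))
    (p : EuclideanSpace ℝ (Fin 3)) : ℝ :=
  ∑ i, fderiv ℝ F p (EuclideanSpace.single i 1) i

/-- Curl of a vector field on ℝ³. -/
noncomputable def curl3 (F : EuclideanSpace ℝ (Fin 3) → EuclideanSpace ℝ (Fin 3))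
    (p : EuclideanSpace ℝ (Fin 3)) : EuclideanSpace ℝ (Fin 3) :=
  (WithLp.equiv 2 (Fin 3 → ℝ)).symm
    ![fderiv ℝ F p (EuclideanSpace.single 1 1) 2 - fderiv ℝ F p (EuclideanSpace.single 2 1) 1,
      fderiv ℝ F p (EuclideanSpace.single 2 1) 0 - fderiv ℝ F p (EuclideanSpace.single 0 1) 2,
      fderiv ℝ F p (EuclideanSpace.single 0 1) 1 - fderiv ℝ F p (EuclideanSpace.single 1 1) 0]

/-- The spurious geometric divergence G(k,v)(p). -/
noncomputable def spuriousG (k v : EuclideanSpace ℝ (Fin 3) → EuclideanSpace ℝ (Fin 3))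
    (p : EuclideanSpace ℝ (Fin 3)) : ℝ :=
  ⟪k p, fderiv ℝ v p (k p)⟫ - ⟪k p, fderiv ℝ k p (v p)⟫

@[simp] theorem cross3_apply (a b : EuclideanSpace ℝ (Fin 3)) (i : Fin 3) :
    cross3 a b i =
      ![a 1 * b 2 - a 2 * b 1, a 2 * b 0 - a 0 * b 2, a 0 * b 1 - a 1 * b 0] i := rfl

/-- The product rule for the cross product of vector fields. -/
theorem fderiv_cross3_apply {k v : EuclideanSpace ℝ (Fin 3) → EuclideanSpace ℝ (Fin 3)}
    {p : EuclideanSpace ℝ (Fin 3)} (hk : DifferentiableAt ℝ k p) (hv : DifferentiableAt ℝ v p)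
    (w : EuclideanSpace ℝ (Fin 3)) :
    fderiv ℝ (fun x => cross3 (k x) (v x)) p w =
      cross3 (k p) (fderiv ℝ v p w) + cross3 (fderiv ℝ k p w) (v p) := by
  have hproj {F : EuclideanSpace ℝ (Fin 3) → EuclideanSpace ℝ (Fin 3)}
      (hF : DifferentiableAt ℝ F p) (i : Fin 3) :
      HasFDerivAt (fun x => F x i) (EuclideanSpace.proj i ∘L fderiv ℝ F p) p :=
    (EuclideanSpace.proj (𝕜 := ℝ) i).hasFDerivAt.comp p hF.hasFDerivAt
  have hki := hproj hk
  have hvi := hproj hv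
  have hmul (i j : Fin 3) := (hki i).mul (hvi j)
  have hcross : DifferentiableAt ℝ (fun x => cross3 (k x) (v x)) p := by
    rw [differentiableAt_euclidean]
    intro i
    fin_cases i
    · exact ((hmul 1 2).sub (hmul 2 1)).differentiableAt
    · exact ((hmul 2 0).sub (hmul 0 2)).differentiableAt
    · exact ((hmul 0 1).sub (hmul 1 0)).differentiableAt
  have hci := hproj hcross
  ext i
  fin_cases i
  · have h := DFunLike.congr_fun ((hci 0).unique ((hmul 1 2).sub (hmul 2 1))) w
    simp at h ⊢
    linarith
  · have h := DFunLike.congr_fun ((hci 1).unique ((hmul 2 0).sub (hmul 0 2))) w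
    simp at h ⊢
    linarith
  · have h := DFunLike.congr_fun ((hci 2).unique ((hmul 0 1).sub (hmul 1 0))) w
    simp at h ⊢
    linarith

theorem map_eq_sum_single (L : EuclideanSpace ℝ (Fin 3) →L[ℝ] EuclideanSpace ℝ (Fin 3))
    (a : EuclideanSpace ℝ (Fin 3)) (j : Fin 3) :
    L a j = ∑ i, a i * L (EuclideanSpace.single i 1) j := by
  have h : a = ∑ i, a i • EuclideanSpace.single i (1 : ℝ) := by
    ext j
    fin_cases j <;> simp [Fin.sum_univ_three]
  conv_lhs => rw [h]
  simp [Fin.sum_univ_three]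

/-- The curl of a cross product. -/
theorem curl3_cross3 {k v : EuclideanSpace ℝ (Fin 3) → EuclideanSpace ℝ (Fin 3)}
    {p : EuclideanSpace ℝ (Fin 3)} (hk : DifferentiableAt ℝ k p)
    (hv : DifferentiableAt ℝ v p) :
    curl3 (fun x => cross3 (k x) (v x)) p =
      div3 v p • k p - div3 k p • v p + fderiv ℝ k p (v p) - fderiv ℝ v p (k p) := by
  ext i
  fin_cases i <;>
  · simp [curl3, div3, fderiv_cross3_apply hk hv, map_eq_sum_single _ (k p),
      map_eq_sum_single _ (v p), Fin.sum_univ_three]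
    ring

theorem curl_cross_inner_unit_tangent
    (k v : EuclideanSpace ℝ (Fin 3) → EuclideanSpace ℝ (Fin 3)) (p : EuclideanSpace ℝ (Fin 3))
    (hk : DifferentiableAt ℝ k p) (hv : DifferentiableAt ℝ v p)
    (hknorm : ‖k p‖ = 1) (horth : ⟪k p, v p⟫ = 0) :
    ⟪k p, curl3 (fun x => cross3 (k x) (v x)) p⟫ = div3 v p - spuriousG k v p := by
  rw [curl3_cross3 hk hv, spuriousG]
  simp only [inner_sub_right, inner_add_right, real_inner_smul_right, horth,
    real_inner_self_eq_norm_sq, hknorm]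
  ring
end

section
/- Let N : ℝ³ \ {0} → ℝ³ be the radial unit field N(x) = x/‖x‖, let p ≠ 0, and let v : ℝ³ → ℝ³ be differentiable at p with ⟨x, v(x)⟩ = 0 for all x in some neighborhood of p. Then ((N·∇)N)(p) = 0, ⟨N(p), ((N·∇)v)(p)⟩ = 0, and ⟨N(p), ((v·∇)N)(p)⟩ = 0; consequently the spurious geometric divergence vanishes: G(N, v)(p) = 0. -/
open scoped RealInnerProductSpace
open Filter

/-- The radial unit field N(x) = x/‖x‖. -/
noncomputable def radialUnit (x : EuclideanSpace ℝ (Fin 3)) : EuclideanSpace ℝ (Fin 3) :=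
  ‖x‖⁻¹ • x

theorem inner_fderiv_add_eq_zero_of_eventually_inner_eq {E F : Type*} [NormedAddCommGroup E]
    [NormedSpace ℝ E] [NormedAddCommGroup F] [InnerProductSpace ℝ F] {f g : E → F} {p : E} {c : ℝ}
    (hf : DifferentiableAt ℝ f p) (hg : DifferentiableAt ℝ g p)
    (h : ∀ᶠ x in nhds p, ⟪f x, g x⟫ = c) (w : E) :
    ⟪f p, fderiv ℝ g p w⟫ + ⟪fderiv ℝ f p w, g p⟫ = 0 := by
  have h' : (fun x => ⟪f x, g x⟫) =ᶠ[nhds p] fun _ => c := h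
  rw [← fderiv_inner_apply ℝ hf hg, h'.fderiv_eq]
  simp

theorem differentiableAt_radialUnit {p : EuclideanSpace ℝ (Fin 3)} (hp : p ≠ 0) :
    DifferentiableAt ℝ radialUnit p :=
  ((differentiableAt_id.norm ℝ hp).inv (norm_ne_zero_iff.mpr hp)).smul differentiableAt_id

theorem inner_radialUnit_self {x : EuclideanSpace ℝ (Fin 3)} (hx : x ≠ 0) :
    ⟪radialUnit x, radialUnit x⟫ = 1 := by
  have := norm_ne_zero_iff.mpr hx
  rw [real_inner_self_eq_norm_sq, radialUnit, norm_smul, norm_inv, norm_norm, inv_mul_cancel₀ this,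
    one_pow]

theorem radialUnit_smul_of_pos {t : ℝ} (ht : 0 < t) (x : EuclideanSpace ℝ (Fin 3)) :
    radialUnit (t • x) = radialUnit x := by
  rw [radialUnit, radialUnit, norm_smul, Real.norm_of_nonneg ht.le, smul_smul, mul_inv,
    mul_right_comm, inv_mul_cancel₀ ht.ne', one_mul]

theorem inner_radialUnit_fderiv_radialUnit {p : EuclideanSpace ℝ (Fin 3)} (hp : p ≠ 0)
    (w : EuclideanSpace ℝ (Fin 3)) : ⟪radialUnit p, fderiv ℝ radialUnit p w⟫ = 0 := by
  have hN := differentiableAt_radialUnit hp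
  have h := inner_fderiv_add_eq_zero_of_eventually_inner_eq hN hN
    ((eventually_ne_nhds hp).mono fun _ hx => inner_radialUnit_self hx) w
  rw [real_inner_comm (radialUnit p) (fderiv ℝ radialUnit p w)] at h
  linarith

theorem fderiv_radialUnit_self {p : EuclideanSpace ℝ (Fin 3)} (hp : p ≠ 0) :
    fderiv ℝ radialUnit p p = 0 := by
  have hline : HasDerivAt (fun t : ℝ => t • p) p 1 := by
    simpa using (hasDerivAt_id (1 : ℝ)).smul_const p
  have hcomp : HasDerivAt (fun t : ℝ => radialUnit (t • p)) (fderiv ℝ radialUnit p p) 1 :=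
    HasFDerivAt.comp_hasDerivAt_of_eq 1 (differentiableAt_radialUnit hp).hasFDerivAt hline
      (one_smul ℝ p).symm
  have hconst : (fun t : ℝ => radialUnit (t • p)) =ᶠ[nhds 1] fun _ => radialUnit p :=
    (eventually_gt_nhds one_pos).mono fun _ ht => radialUnit_smul_of_pos ht p
  exact hcomp.unique ((hasDerivAt_const 1 (radialUnit p)).congr_of_eventuallyEq hconst)

theorem spurious_divergence_vanishes_radial
    (v : EuclideanSpace ℝ (Fin 3) → EuclideanSpace ℝ (Fin 3)) (p : EuclideanSpace ℝ (Fin 3))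
    (hp : p ≠ 0) (hv : DifferentiableAt ℝ v p)
    (htang : ∀ᶠ x in nhds p, ⟪x, v x⟫ = 0) :
    fderiv ℝ radialUnit p (radialUnit p) = 0 ∧
      ⟪radialUnit p, fderiv ℝ v p (radialUnit p)⟫ = 0 ∧
      ⟪radialUnit p, fderiv ℝ radialUnit p (v p)⟫ = 0 ∧
      ⟪radialUnit p, fderiv ℝ v p (radialUnit p)⟫ -
          ⟪radialUnit p, fderiv ℝ radialUnit p (v p)⟫ = 0 := by
  have hNv : ⟪radialUnit p, fderiv ℝ v p (radialUnit p)⟫ = 0 := by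
    have h := inner_fderiv_add_eq_zero_of_eventually_inner_eq differentiableAt_id hv htang p
    have h0 : ⟪p, v p⟫ = 0 := htang.self_of_nhds
    simp only [id, fderiv_id, ContinuousLinearMap.id_apply, h0, add_zero] at h
    simp [radialUnit, real_inner_smul_left, real_inner_smul_right, h]
  have hvN := inner_radialUnit_fderiv_radialUnit hp (v p)
  refine ⟨?_, hNv, hvN, by rw [hNv, hvN, sub_zero]⟩
  rw [show radialUnit p = ‖p‖⁻¹ • p from rfl, map_smul, fderiv_radialUnit_self hp, smul_zero]
end

section
/- Let N : ℝ³ \ {0} → ℝ³ be the radial unit field N(x) = x/‖x‖, let p ≠ 0, and let v : ℝ³ → ℝ³ be differentiable at p with ⟨x, v(x)⟩ = 0 for all x in some neighborhood of p. Then ⟨N(p), curl(N × v)(p)⟩ = div v(p); that is, for a field tangent to the spheres centered at the origin and the exact spherical unit normal, the modified Stokes integrand reduces exactly to the divergence of v. -/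
open scoped RealInnerProductSpace

open Filter

theorem hasFDerivAt_inv_norm {E : Type*} [NormedAddCommGroup E] [InnerProductSpace ℝ E]
    {p : E} (hp : p ≠ 0) :
    HasFDerivAt (fun x : E => ‖x‖⁻¹) (-(‖p‖ ^ 3)⁻¹ • innerSL ℝ p) p := by
  have hn : ‖p‖ ≠ 0 := norm_ne_zero_iff.mpr hp
  have hs := (hasFDerivAt_id (𝕜 := ℝ) p).norm_sq.sqrt (by simpa using hp)
  simp only [id, Real.sqrt_sq (norm_nonneg _)] at hs
  refine ((hasDerivAt_inv hn).comp_hasFDerivAt p hs).congr_fderiv ?_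
  ext y
  simp
  field_simp

theorem hasFDerivAt_euclidean_apply {E ι : Type*} [NormedAddCommGroup E] [NormedSpace ℝ E]
    [Fintype ι] {F : E → EuclideanSpace ℝ ι} {F' : E →L[ℝ] EuclideanSpace ℝ ι} {p : E}
    (hF : HasFDerivAt F F' p) (i : ι) :
    HasFDerivAt (fun x => F x i) ((EuclideanSpace.proj i : EuclideanSpace ℝ ι →L[ℝ] ℝ).comp F') p :=
  (EuclideanSpace.proj i : EuclideanSpace ℝ ι →L[ℝ] ℝ).hasFDerivAt.comp p hF

/-- The derivative of a coordinate of the cross product of `x / ‖x‖` with a field `v`. -/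
theorem hasFDerivAt_radial_minor {ι : Type*} [Fintype ι]
    {v : EuclideanSpace ℝ ι → EuclideanSpace ℝ ι} {p : EuclideanSpace ℝ ι}
    (hp : p ≠ 0) (hv : DifferentiableAt ℝ v p) (a b : ι) :
    ∃ L : EuclideanSpace ℝ ι →L[ℝ] ℝ,
      HasFDerivAt (fun x => ‖x‖⁻¹ * x a * v x b - ‖x‖⁻¹ * x b * v x a) L p ∧
      ∀ h, L h = -(‖p‖ ^ 3)⁻¹ * ⟪p, h⟫ * (p a * v p b - p b * v p a) +
        ‖p‖⁻¹ * (h a * v p b + p a * fderiv ℝ v p h b - h b * v p a - p b * fderiv ℝ v p h a) := by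
  have hc := hasFDerivAt_inv_norm hp
  have hx := hasFDerivAt_euclidean_apply (hasFDerivAt_id (𝕜 := ℝ) p)
  have hw := hasFDerivAt_euclidean_apply hv.hasFDerivAt
  refine ⟨_, ((hc.mul (hx a)).mul (hw b)).sub ((hc.mul (hx b)).mul (hw a)), fun h => ?_⟩
  simp
  ring

/-- A field tangent to the spheres centered at the origin has a tangential radial derivative. -/
theorem inner_fderiv_self_eq_zero {E : Type*} [NormedAddCommGroup E] [InnerProductSpace ℝ E]
    {v : E → E} {p : E} (hv : DifferentiableAt ℝ v p) (htang : ∀ᶠ x in nhds p, ⟪x, v x⟫ = 0) :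
    ⟪p, fderiv ℝ v p p⟫ = 0 := by
  have h := (hasFDerivAt_id (𝕜 := ℝ) p).inner ℝ hv.hasFDerivAt
  have h0 : HasFDerivAt (fun x => ⟪id x, v x⟫) (0 : E →L[ℝ] ℝ) p :=
    (hasFDerivAt_const (0 : ℝ) p).congr_of_eventuallyEq htang
  have := DFunLike.congr_fun (h.unique h0) p
  simpa [htang.self_of_nhds] using this

theorem curl_cross_radial_eq_div
    (v : EuclideanSpace ℝ (Fin 3) → EuclideanSpace ℝ (Fin 3)) (p : EuclideanSpace ℝ (Fin 3))
    (hp : p ≠ 0) (hv : DifferentiableAt ℝ v p)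
    (htang : ∀ᶠ x in nhds p, ⟪x, v x⟫ = 0) :
    ⟪radialUnit p, curl3 (fun x => cross3 (radialUnit x) (v x)) p⟫ = div3 v p := by
  have hpv := htang.self_of_nhds
  have hrad := inner_fderiv_self_eq_zero hv htang
  have hdecomp : fderiv ℝ v p p = ∑ i, p i • fderiv ℝ v p (EuclideanSpace.single i 1) := by
    have := congrArg (fderiv ℝ v p) ((EuclideanSpace.basisFun (Fin 3) ℝ).sum_repr p)
    simpa using this.symm
  obtain ⟨L0, hL0, e0⟩ := hasFDerivAt_radial_minor hp hv 1 2
  obtain ⟨L1, hL1, e1⟩ := hasFDerivAt_radial_minor hp hv 2 0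
  obtain ⟨L2, hL2, e2⟩ := hasFDerivAt_radial_minor hp hv 0 1
  have hd : DifferentiableAt ℝ (fun x => cross3 (radialUnit x) (v x)) p := by
    rw [differentiableAt_euclidean]
    intro i
    fin_cases i
    exacts [hL0.differentiableAt, hL1.differentiableAt, hL2.differentiableAt]
  have hcomp := hasFDerivAt_euclidean_apply hd.hasFDerivAt
  have c0 : ∀ h, fderiv ℝ (fun x => cross3 (radialUnit x) (v x)) p h 0 = L0 h :=
    DFunLike.congr_fun ((hcomp 0).unique hL0)
  have c1 : ∀ h, fderiv ℝ (fun x => cross3 (radialUnit x) (v x)) p h 1 = L1 h :=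
    DFunLike.congr_fun ((hcomp 1).unique hL1)
  have c2 : ∀ h, fderiv ℝ (fun x => cross3 (radialUnit x) (v x)) p h 2 = L2 h :=
    DFunLike.congr_fun ((hcomp 2).unique hL2)
  have hn : ‖p‖ ≠ 0 := norm_ne_zero_iff.mpr hp
  have hsq := EuclideanSpace.real_norm_sq_eq p
  rw [hdecomp] at hrad
  simp [PiLp.inner_apply, Fin.sum_univ_three] at hrad hpv hsq
  rw [curl3, c0, c0, c1, c1, c2, c2]
  simp only [e0, e1, e2, div3, radialUnit]
  clear e0 e1 e2 c0 c1 c2 hcomp hd hL0 hL1 hL2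
  simp [PiLp.inner_apply, Fin.sum_univ_three]
  generalize fderiv ℝ v p (EuclideanSpace.single 0 1) = d0 at *
  generalize fderiv ℝ v p (EuclideanSpace.single 1 1) = d1 at *
  generalize fderiv ℝ v p (EuclideanSpace.single 2 1) = d2 at *
  generalize ‖p‖ = r at *
  field_simp
  linear_combination -(d0 0 + d1 1 + d2 2) * r ^ 2 * hsq - r ^ 2 * hrad - 2 * r ^ 2 * hpv
end

section
/- Define V on U = {(x, y, z) ∈ ℝ³ : x² + y² > 0} by V(x, y, z) = ( z x/(x² + y²) − y/√(x² + y²), z y/(x² + y²) + x/√(x² + y²), −1 ). Then for every p = (x, y, z) ∈ U: (i) ⟨V(p), p⟩ = 0, so V is tangent to every sphere centered at the origin; and (ii) V is differentiable at p with div V(p) = 0. -/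
open scoped RealInnerProductSpace

/-- Cartesian expression of the test field v = (1/sin θ) θ̂ + φ̂, extended
homogeneously of degree zero. -/
noncomputable def Vfield (x : EuclideanSpace ℝ (Fin 3)) : EuclideanSpace ℝ (Fin 3) :=
  (WithLp.equiv 2 (Fin 3 → ℝ)).symm
    ![x 2 * x 0 / (x 0 ^ 2 + x 1 ^ 2) - x 1 / Real.sqrt (x 0 ^ 2 + x 1 ^ 2),
      x 2 * x 1 / (x 0 ^ 2 + x 1 ^ 2) + x 0 / Real.sqrt (x 0 ^ 2 + x 1 ^ 2),
      -1]

theorem hasFDerivAt_coord (p : EuclideanSpace ℝ (Fin 3)) (i : Fin 3) :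
    HasFDerivAt (fun x : EuclideanSpace ℝ (Fin 3) => x i)
      (EuclideanSpace.proj i : EuclideanSpace ℝ (Fin 3) →L[ℝ] ℝ) p :=
  (EuclideanSpace.proj i : EuclideanSpace ℝ (Fin 3) →L[ℝ] ℝ).hasFDerivAt

/-- The divergence is the sum of the partial derivatives of the components. -/
theorem div3_eq_sum_fderiv_coord {F : EuclideanSpace ℝ (Fin 3) → EuclideanSpace ℝ (Fin 3)}
    {p : EuclideanSpace ℝ (Fin 3)} (hF : DifferentiableAt ℝ F p) :
    div3 F p = ∑ i, fderiv ℝ (fun x => F x i) p (EuclideanSpace.single i 1) := by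
  refine Finset.sum_congr rfl fun i _ => ?_
  have h : HasFDerivAt (fun x => F x i) _ p := (hasFDerivAt_coord (F p) i).comp p hF.hasFDerivAt
  rw [h.fderiv]
  rfl

theorem HasFDerivAt.div_real {E : Type*} [NormedAddCommGroup E] [NormedSpace ℝ E]
    {f g : E → ℝ} {f' g' : E →L[ℝ] ℝ} {x : E} (hf : HasFDerivAt f f' x)
    (hg : HasFDerivAt g g' x) (hx : g x ≠ 0) :
    HasFDerivAt (fun y => f y / g y) ((g x ^ 2)⁻¹ • (g x • f' - f x • g')) x := by
  simp only [div_eq_mul_inv]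
  refine (hf.fun_mul ((hasDerivAt_inv hx).comp_hasFDerivAt x hg)).congr_fderiv ?_
  ext v
  simp only [add_apply, sub_apply, smul_apply, smul_eq_mul, Function.comp_apply]
  field_simp
  ring

theorem Vfield_tangent_and_divergence_free (p : EuclideanSpace ℝ (Fin 3))
    (hp : p 0 ^ 2 + p 1 ^ 2 > 0) :
    ⟪Vfield p, p⟫ = 0 ∧ DifferentiableAt ℝ Vfield p ∧ div3 Vfield p = 0 := by
  have hr : p 0 ^ 2 + p 1 ^ 2 ≠ 0 := hp.ne'
  have hs : Real.sqrt (p 0 ^ 2 + p 1 ^ 2) ≠ 0 := (Real.sqrt_pos.mpr hp).ne'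
  have hd (i : Fin 3) := hasFDerivAt_coord p i
  have hq : HasFDerivAt (fun x : EuclideanSpace ℝ (Fin 3) => x 0 ^ 2 + x 1 ^ 2)
      (((2 : ℕ) • p 0 ^ (2 - 1)) • (EuclideanSpace.proj 0 : EuclideanSpace ℝ (Fin 3) →L[ℝ] ℝ) +
        ((2 : ℕ) • p 1 ^ (2 - 1)) • (EuclideanSpace.proj 1 : EuclideanSpace ℝ (Fin 3) →L[ℝ] ℝ)) p :=
    ((hd 0).pow 2).add ((hd 1).pow 2)
  have h0 : HasFDerivAt (fun x => Vfield x 0) _ p :=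
    (((hd 2).fun_mul (hd 0)).div_real hq hr).fun_sub ((hd 1).div_real (hq.sqrt hr) hs)
  have h1 : HasFDerivAt (fun x => Vfield x 1) _ p :=
    (((hd 2).fun_mul (hd 1)).div_real hq hr).fun_add ((hd 0).div_real (hq.sqrt hr) hs)
  have h2 : HasFDerivAt (fun x => Vfield x 2) (0 : EuclideanSpace ℝ (Fin 3) →L[ℝ] ℝ) p :=
    hasFDerivAt_const (-1 : ℝ) p
  have hV : DifferentiableAt ℝ Vfield p := by
    rw [differentiableAt_euclidean]
    intro i
    fin_cases i
    · exact h0.differentiableAt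
    · exact h1.differentiableAt
    · exact h2.differentiableAt
  refine ⟨?_, hV, ?_⟩
  · simp only [Vfield, PiLp.inner_apply, Fin.sum_univ_three]
    simp
    field_simp
    ring
  · rw [div3_eq_sum_fderiv_coord hV, Fin.sum_univ_three, h0.fderiv, h1.fderiv, h2.fderiv]
    simp
    field_simp
    ring
end
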